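/- arXiv:2409.04687 — 2 statements merged into one kernel-verified Lean document; each statement's English description precedes it below -/
import Mathlib

section
/- Let H be a Hopf G-coalgebra with bijective antipode, A an H-comodule Poisson algebra, φ : H → A a right H-colinear map with φ_α(1_{H_α}) = 1_{A_α}, and M a Poisson (A,H)-Hopf module. Define p_α^M : M_e → M_α by p_α^M(m) = φ_α(S_α^{-1}(m_{(1,α⁻¹)})) · m_{(0,α)}. Then {(p_α^M(m))_{α∈G} : m ∈ M_e} = M^{coH}, i.e., the family (p_α^M(m))_α is coinvariant for each m ∈ M_e, and every coinvariant family arises this way. -/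
open TensorProduct

noncomputable section

set_option synthInstance.maxHeartbeats 1000000
set_option maxHeartbeats 2000000

/-- Transport along an equality of indices for a family of modules. -/
def famCast {k : Type*} [CommSemiring k] {G : Type*} {H : G → Type*}
    [∀ α, AddCommMonoid (H α)] [∀ α, Module k (H α)] {x y : G} (h : x = y) :
    H x →ₗ[k] H y := by subst h; exact LinearMap.id

/-- A Hopf `G`-coalgebra over `k`. -/
structure HopfGCoalgebra (k G : Type*) [Field k] [CommGroup G] where
  H : G → Type*
  [ring : ∀ α, Ring (H α)]
  [alg : ∀ α, Algebra k (H α)]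
  Δ : ∀ α β : G, H (α * β) →ₐ[k] H α ⊗[k] H β
  ε : H 1 →ₐ[k] k
  coassoc : ∀ α β γ : G,
    (TensorProduct.assoc k (H α) (H β) (H γ)).toLinearMap ∘ₗ
      TensorProduct.map (Δ α β).toLinearMap LinearMap.id ∘ₗ (Δ (α * β) γ).toLinearMap
    = TensorProduct.map LinearMap.id (Δ β γ).toLinearMap ∘ₗ (Δ α (β * γ)).toLinearMap ∘ₗ
        famCast (k := k) (mul_assoc α β γ)
  counit_left : ∀ α : G,
    (TensorProduct.lid k (H α)).toLinearMap ∘ₗ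
      TensorProduct.map ε.toLinearMap LinearMap.id ∘ₗ (Δ 1 α).toLinearMap
    = famCast (k := k) (one_mul α)
  counit_right : ∀ α : G,
    (TensorProduct.rid k (H α)).toLinearMap ∘ₗ
      TensorProduct.map LinearMap.id ε.toLinearMap ∘ₗ (Δ α 1).toLinearMap
    = famCast (k := k) (mul_one α)
  S : ∀ α : G, H α →ₗ[k] H α⁻¹
  antipode_left : ∀ α : G,
    LinearMap.mul' k (H α) ∘ₗ
      TensorProduct.map (famCast (k := k) (inv_inv α) ∘ₗ S α⁻¹) LinearMap.id ∘ₗ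
      (Δ α⁻¹ α).toLinearMap ∘ₗ famCast (k := k) (inv_mul_cancel α).symm
    = Algebra.linearMap k (H α) ∘ₗ ε.toLinearMap
  antipode_right : ∀ α : G,
    LinearMap.mul' k (H α⁻¹) ∘ₗ
      TensorProduct.map LinearMap.id (S α) ∘ₗ
      (Δ α⁻¹ α).toLinearMap ∘ₗ famCast (k := k) (inv_mul_cancel α).symm
    = Algebra.linearMap k (H α⁻¹) ∘ₗ ε.toLinearMap

attribute [instance] HopfGCoalgebra.ring HopfGCoalgebra.alg
variable {k G : Type*} [Field k] [CommGroup G]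

/-- A family of Poisson algebras which is a right `H`-comodule Poisson algebra. -/
structure GComodulePoissonAlgebra (Hc : HopfGCoalgebra k G) where
  A : G → Type*
  [cring : ∀ α, CommRing (A α)]
  [alg : ∀ α, Algebra k (A α)]
  pb : ∀ α : G, A α →ₗ[k] A α →ₗ[k] A α
  pb_skew : ∀ (α : G) (a b : A α), pb α a b = - pb α b a
  pb_jacobi : ∀ (α : G) (a b c : A α),
    pb α a (pb α b c) = pb α (pb α a b) c + pb α b (pb α a c)
  pb_leibniz : ∀ (α : G) (a b c : A α), pb α a (b * c) = pb α a b * c + b * pb α a c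
  ρ : ∀ α β : G, A (α * β) →ₐ[k] A α ⊗[k] Hc.H β
  coassoc : ∀ α β γ : G,
    (TensorProduct.assoc k (A α) (Hc.H β) (Hc.H γ)).toLinearMap ∘ₗ
      TensorProduct.map (ρ α β).toLinearMap LinearMap.id ∘ₗ (ρ (α * β) γ).toLinearMap
    = TensorProduct.map LinearMap.id (Hc.Δ β γ).toLinearMap ∘ₗ (ρ α (β * γ)).toLinearMap ∘ₗ
        famCast (k := k) (mul_assoc α β γ)
  counit : ∀ α : G,
    (TensorProduct.rid k (A α)).toLinearMap ∘ₗ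
      TensorProduct.map LinearMap.id Hc.ε.toLinearMap ∘ₗ (ρ α 1).toLinearMap
    = famCast (k := k) (mul_one α)
  pb_comp : ∀ α β : G,
    (ρ α β).toLinearMap ∘ₗ TensorProduct.lift (pb (α * β))
    = TensorProduct.map (TensorProduct.lift (pb α)) (LinearMap.mul' k (Hc.H β)) ∘ₗ
        (TensorProduct.tensorTensorTensorComm k (A α) (Hc.H β) (A α) (Hc.H β)).toLinearMap ∘ₗ
        TensorProduct.map (ρ α β).toLinearMap (ρ α β).toLinearMap

attribute [instance] GComodulePoissonAlgebra.cring GComodulePoissonAlgebra.alg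

/-- A Poisson `(A,H)`-Hopf module. -/
structure PoissonHopfModule {Hc : HopfGCoalgebra k G}
    (Ac : GComodulePoissonAlgebra Hc) where
  M : G → Type*
  [acg : ∀ α, AddCommGroup (M α)]
  [mod : ∀ α, Module k (M α)]
  smul : ∀ α : G, Ac.A α →ₗ[k] M α →ₗ[k] M α
  one_smul : ∀ (α : G) (m : M α), smul α 1 m = m
  mul_smul : ∀ (α : G) (a b : Ac.A α) (m : M α), smul α (a * b) m = smul α a (smul α b m)
  dia : ∀ α : G, Ac.A α →ₗ[k] M α →ₗ[k] M α
  dia_lie : ∀ (α : G) (a b : Ac.A α) (m : M α),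
    dia α (Ac.pb α a b) m = dia α a (dia α b m) - dia α b (dia α a m)
  poisson1 : ∀ (α : G) (a b : Ac.A α) (m : M α),
    dia α a (smul α b m) = smul α (Ac.pb α a b) m + smul α b (dia α a m)
  poisson2 : ∀ (α : G) (a b : Ac.A α) (m : M α),
    dia α (a * b) m = smul α a (dia α b m) + smul α b (dia α a m)
  ρ : ∀ α β : G, M (α * β) →ₗ[k] M α ⊗[k] Hc.H β
  coassoc : ∀ α β γ : G,
    (TensorProduct.assoc k (M α) (Hc.H β) (Hc.H γ)).toLinearMap ∘ₗ
      TensorProduct.map (ρ α β) LinearMap.id ∘ₗ ρ (α * β) γ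
    = TensorProduct.map LinearMap.id (Hc.Δ β γ).toLinearMap ∘ₗ ρ α (β * γ) ∘ₗ
        famCast (k := k) (mul_assoc α β γ)
  counit : ∀ α : G,
    (TensorProduct.rid k (M α)).toLinearMap ∘ₗ
      TensorProduct.map LinearMap.id Hc.ε.toLinearMap ∘ₗ ρ α 1
    = famCast (k := k) (mul_one α)
  smul_comp : ∀ α β : G,
    ρ α β ∘ₗ TensorProduct.lift (smul (α * β))
    = TensorProduct.map (TensorProduct.lift (smul α)) (LinearMap.mul' k (Hc.H β)) ∘ₗ
        (TensorProduct.tensorTensorTensorComm k (Ac.A α) (Hc.H β) (M α) (Hc.H β)).toLinearMap ∘ₗ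
        TensorProduct.map (Ac.ρ α β).toLinearMap (ρ α β)
  dia_comp : ∀ α β : G,
    ρ α β ∘ₗ TensorProduct.lift (dia (α * β))
    = TensorProduct.map (TensorProduct.lift (dia α)) (LinearMap.mul' k (Hc.H β)) ∘ₗ
        (TensorProduct.tensorTensorTensorComm k (Ac.A α) (Hc.H β) (M α) (Hc.H β)).toLinearMap ∘ₗ
        TensorProduct.map (Ac.ρ α β).toLinearMap (ρ α β)

attribute [instance] PoissonHopfModule.acg PoissonHopfModule.mod

variable {Hc : HopfGCoalgebra k G} {Ac : GComodulePoissonAlgebra Hc}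

/-- A coinvariant family for a Poisson Hopf module. -/
def PoissonHopfModule.IsCoinv (Mc : PoissonHopfModule Ac) (m : ∀ γ : G, Mc.M γ) : Prop :=
  ∀ γ β : G, Mc.ρ γ β (m (γ * β)) = m γ ⊗ₜ[k] (1 : Hc.H β)

/-- A coinvariant family for the comodule algebra `A`. -/
def GComodulePoissonAlgebra.IsCoinv (Ac : GComodulePoissonAlgebra Hc)
    (a : ∀ γ : G, Ac.A γ) : Prop :=
  ∀ γ β : G, Ac.ρ γ β (a (γ * β)) = a γ ⊗ₜ[k] (1 : Hc.H β)

/-- `M^{A_α}_α`, the space of elements killed by the Lie action. -/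
def PoissonHopfModule.diaInv (Mc : PoissonHopfModule Ac) (α : G) :
    Submodule k (Mc.M α) where
  carrier := {m | ∀ a : Ac.A α, Mc.dia α a m = 0}
  zero_mem' := fun a => map_zero _
  add_mem' := fun {x y} hx hy a => by rw [map_add, hx a, hy a, add_zero]
  smul_mem' := fun c x hx a => by rw [map_smul, hx a, smul_zero]

/-- The Poisson-central part `A^{A_α}_α` of `A_α`. -/
def GComodulePoissonAlgebra.center (Ac : GComodulePoissonAlgebra Hc) (α : G) :
    Submodule k (Ac.A α) where
  carrier := {a | ∀ b : Ac.A α, Ac.pb α a b = 0}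
  zero_mem' := fun b => by rw [map_zero]; rfl
  add_mem' := fun {x y} hx hy b => by rw [map_add]; simp [hx b, hy b]
  smul_mem' := fun c x hx b => by rw [map_smul]; simp [hx b]

/-- `M^{coH}_α` for a Poisson Hopf module. -/
def PoissonHopfModule.coinv (Mc : PoissonHopfModule Ac) (α : G) : Set (Mc.M α) :=
  {x | ∃ m : ∀ γ : G, Mc.M γ, Mc.IsCoinv m ∧ m α = x}

/-- `A^{coH}_α`. -/
def GComodulePoissonAlgebra.coinv (Ac : GComodulePoissonAlgebra Hc) (α : G) :
    Set (Ac.A α) :=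
  {x | ∃ a : ∀ γ : G, Ac.A γ, Ac.IsCoinv a ∧ a α = x}

/-- `p^M_α : M_e → M_α`, `m ↦ φ_α(S_α⁻¹(m_{(1,α⁻¹)})) · m_{(0,α)}`. -/
def pMapM (Mc : PoissonHopfModule Ac) (φ : ∀ α : G, Hc.H α →ₗ[k] Ac.A α)
    (Sinv : ∀ α : G, Hc.H α⁻¹ →ₗ[k] Hc.H α) (α : G) : Mc.M 1 →ₗ[k] Mc.M α :=
  TensorProduct.lift ((Mc.smul α).flip) ∘ₗ
    TensorProduct.map LinearMap.id (φ α ∘ₗ Sinv α) ∘ₗ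
    Mc.ρ α α⁻¹ ∘ₗ famCast (k := k) (mul_inv_cancel α).symm

variable (Ac) in
/-- `p^A_α : A_e → A_α`, `a ↦ φ_α(S_α⁻¹(a_{(1,α⁻¹)})) a_{(0,α)}`. -/
def pMapA (φ : ∀ α : G, Hc.H α →ₗ[k] Ac.A α)
    (Sinv : ∀ α : G, Hc.H α⁻¹ →ₗ[k] Hc.H α) (α : G) : Ac.A 1 →ₗ[k] Ac.A α :=
  LinearMap.mul' k (Ac.A α) ∘ₗ
    TensorProduct.map LinearMap.id (φ α ∘ₗ Sinv α) ∘ₗ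
    (Ac.ρ α α⁻¹).toLinearMap ∘ₗ famCast (k := k) (mul_inv_cancel α).symm

/-- `H`-colinearity for a family of maps `φ : H → A`. -/
def PhiColinear (φ : ∀ α : G, Hc.H α →ₗ[k] Ac.A α) : Prop :=
  ∀ α β : G,
    (Ac.ρ α β).toLinearMap ∘ₗ φ (α * β)
      = TensorProduct.map (φ α) LinearMap.id ∘ₗ (Hc.Δ α β).toLinearMap

/-- `Sinv` is a family of two-sided inverses of the antipode. -/
def IsAntipodeInv (Hc : HopfGCoalgebra k G)
    (Sinv : ∀ α : G, Hc.H α⁻¹ →ₗ[k] Hc.H α) : Prop :=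
  ∀ α : G, Sinv α ∘ₗ Hc.S α = LinearMap.id ∧ Hc.S α ∘ₗ Sinv α = LinearMap.id

namespace PMapAux

/-- Comultiplication with a free source index. -/
def D (Hc : HopfGCoalgebra k G) {x y z : G} (h : x = y * z) :
    Hc.H x →ₐ[k] Hc.H y ⊗[k] Hc.H z := by subst h; exact Hc.Δ y z

/-- Coaction with a free source index. -/
def R {Hc : HopfGCoalgebra k G} {Ac : GComodulePoissonAlgebra Hc} (Mc : PoissonHopfModule Ac)
    {x y z : G} (h : x = y * z) :
    Mc.M x →ₗ[k] Mc.M y ⊗[k] Hc.H z := by subst h; exact Mc.ρ y z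

/-- Antipode with free target index. -/
def A (Hc : HopfGCoalgebra k G) {x y : G} (h : y = x⁻¹) : Hc.H x →ₗ[k] Hc.H y := by
  subst h; exact Hc.S x

/-- Inverse antipode with free source index. -/
def T {Hc : HopfGCoalgebra k G} (Sinv : ∀ α : G, Hc.H α⁻¹ →ₗ[k] Hc.H α)
    {x y : G} (h : y = x⁻¹) : Hc.H y →ₗ[k] Hc.H x := by
  subst h; exact Sinv x

theorem D_apply (Hc : HopfGCoalgebra k G) {x y z : G} (h : x = y * z) (t : Hc.H x) :
    D Hc h t = Hc.Δ y z (famCast (k := k) h t) := by subst h; rfl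

theorem R_apply (Mc : PoissonHopfModule Ac) {x y z : G} (h : x = y * z) (t : Mc.M x) :
    R Mc h t = Mc.ρ y z (famCast (k := k) h t) := by subst h; rfl

theorem D_coassoc (Hc : HopfGCoalgebra k G) {x p q a b c : G} (h1 : x = p * c) (h2 : p = a * b)
    (h3 : q = b * c) (h4 : x = a * q) (t : Hc.H x) :
    TensorProduct.assoc k _ _ _
      (TensorProduct.map (D Hc h2).toLinearMap LinearMap.id (D Hc h1 t))
    = TensorProduct.map LinearMap.id (D Hc h3).toLinearMap (D Hc h4 t) := by
  subst h2 h3 h1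
  rw [D_apply Hc h4]
  exact LinearMap.congr_fun (Hc.coassoc a b c) t

theorem R_coassoc (Mc : PoissonHopfModule Ac) {x p q a b c : G} (h1 : x = p * c) (h2 : p = a * b)
    (h3 : q = b * c) (h4 : x = a * q) (t : Mc.M x) :
    TensorProduct.assoc k _ _ _
      (TensorProduct.map (R Mc h2) LinearMap.id (R Mc h1 t))
    = TensorProduct.map LinearMap.id (D Hc h3).toLinearMap (R Mc h4 t) := by
  subst h2 h3 h1
  rw [R_apply Mc h4]
  exact LinearMap.congr_fun (Mc.coassoc a b c) t

theorem famCast_self {H : G → Type*}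
    [∀ α, AddCommMonoid (H α)] [∀ α, Module k (H α)] {x : G} (h : x = x) (t : H x) :
    famCast (k := k) h t = t := rfl

theorem famCast_famCast {H : G → Type*}
    [∀ α, AddCommMonoid (H α)] [∀ α, Module k (H α)] {x y z : G} (h : x = y) (h' : y = z)
    (t : H x) :
    famCast (k := k) h' (famCast (k := k) h t) = famCast (k := k) (h.trans h') t := by
  subst h h'; rfl

theorem D_counit_left (Hc : HopfGCoalgebra k G) {x : G} (h : x = 1 * x) (t : Hc.H x) :
    TensorProduct.lid k _ (TensorProduct.map Hc.ε.toLinearMap LinearMap.id (D Hc h t)) = t := by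
  rw [D_apply]
  refine (LinearMap.congr_fun (Hc.counit_left x) _).trans ?_
  rw [famCast_famCast]; rfl

theorem D_counit_right (Hc : HopfGCoalgebra k G) {x : G} (h : x = x * 1) (t : Hc.H x) :
    TensorProduct.rid k _ (TensorProduct.map LinearMap.id Hc.ε.toLinearMap (D Hc h t)) = t := by
  rw [D_apply]
  refine (LinearMap.congr_fun (Hc.counit_right x) _).trans ?_
  rw [famCast_famCast]; rfl

theorem A_right (Hc : HopfGCoalgebra k G) {x y : G} (h : y = x⁻¹) (h' : 1 = y * x) (t : Hc.H 1) :
    LinearMap.mul' k (Hc.H y) (TensorProduct.map LinearMap.id (A Hc h) (D Hc h' t))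
      = algebraMap k _ (Hc.ε t) := by
  subst h
  rw [D_apply]
  exact LinearMap.congr_fun (Hc.antipode_right x) t

theorem A_left (Hc : HopfGCoalgebra k G) {x y : G} (h : y = x⁻¹) (h' : 1 = x * y) (t : Hc.H 1) :
    LinearMap.mul' k (Hc.H y) (TensorProduct.map (A Hc h) LinearMap.id (D Hc h' t))
      = algebraMap k _ (Hc.ε t) := by
  obtain rfl : x = y⁻¹ := by rw [h, inv_inv]
  rw [D_apply]
  have e : A Hc h = famCast (k := k) (inv_inv y) ∘ₗ Hc.S y⁻¹ := by
    have : ∀ {u v w : G} (h1 : v = u⁻¹) (h2 : u⁻¹ = v),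
      A Hc h1 = famCast (k := k) h2 ∘ₗ Hc.S u := by
      intro u v w h1 h2; subst h1; rfl
    exact this (w := 1) _ _
  rw [e]
  exact LinearMap.congr_fun (Hc.antipode_left y) t

/-- If `F(y₁) y₂ = ε(y) b`, then `F(y) = b S(y)`. -/
theorem conv_right (Hc : HopfGCoalgebra k G) {x y : G} (h : y = x⁻¹) (h' : 1 = x * y)
    (F : Hc.H x →ₗ[k] Hc.H y) (b : Hc.H y)
    (hF : ∀ t : Hc.H 1, LinearMap.mul' k (Hc.H y)
      (TensorProduct.map F LinearMap.id (D Hc h' t)) = Hc.ε t • b) (t : Hc.H x) :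
    F t = b * A Hc h t := by
  have hyx : 1 = y * x := by rw [h', mul_comm]
  have co := D_coassoc Hc (one_mul x).symm h' hyx (mul_one x).symm t
  let W : (Hc.H x ⊗[k] Hc.H y) ⊗[k] Hc.H x →ₗ[k] Hc.H y :=
    LinearMap.mul' k _ ∘ₗ
      TensorProduct.map (LinearMap.mul' k _ ∘ₗ TensorProduct.map F LinearMap.id) (A Hc h)
  have e1 : W ∘ₗ TensorProduct.map (D Hc h').toLinearMap LinearMap.id =
      LinearMap.mulLeft k b ∘ₗ A Hc h ∘ₗ (TensorProduct.lid k _).toLinearMap ∘ₗ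
        TensorProduct.map Hc.ε.toLinearMap LinearMap.id := by
    ext u v
    simp [W, hF]
  have e2 : W ∘ₗ (TensorProduct.assoc k _ _ _).symm.toLinearMap ∘ₗ
      TensorProduct.map LinearMap.id (D Hc hyx).toLinearMap =
      F ∘ₗ (TensorProduct.rid k _).toLinearMap ∘ₗ
        TensorProduct.map LinearMap.id Hc.ε.toLinearMap := by
    have e3 : W ∘ₗ (TensorProduct.assoc k _ _ _).symm.toLinearMap =
        LinearMap.mul' k _ ∘ₗ TensorProduct.map F
          (LinearMap.mul' k _ ∘ₗ TensorProduct.map LinearMap.id (A Hc h)) := by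
      ext u v w
      simp [W, mul_assoc]
    rw [← LinearMap.comp_assoc, e3]
    ext u v
    simp [A_right Hc h hyx, Algebra.algebraMap_eq_smul_one]
  have f1 := LinearMap.congr_fun e1 (D Hc (one_mul x).symm t)
  have f2 := LinearMap.congr_fun e2 (D Hc (mul_one x).symm t)
  simp only [LinearMap.comp_apply, LinearEquiv.coe_coe, D_counit_left, D_counit_right,
    LinearMap.mulLeft_apply] at f1 f2
  rw [← f1, ← f2, ← co, LinearEquiv.symm_apply_apply]

theorem A_one (Hc : HopfGCoalgebra k G) {x y : G} (h : y = x⁻¹) : A Hc h 1 = 1 := by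
  have := A_left Hc h (by rw [h, mul_inv_cancel]) 1
  simpa [Algebra.TensorProduct.one_def] using this

theorem A_mul (Hc : HopfGCoalgebra k G) {x y : G} (h : y = x⁻¹) (u v : Hc.H x) :
    A Hc h (u * v) = A Hc h v * A Hc h u := by
  have h' : 1 = x * y := by rw [h, mul_inv_cancel]
  refine conv_right Hc h h' (A Hc h ∘ₗ LinearMap.mulRight k v) _ ?_ u
  intro s
  -- `F v = S(s₁ v) s₂`
  let B : Hc.H x →ₗ[k] (Hc.H x ⊗[k] Hc.H y) →ₗ[k] Hc.H y :=
    LinearMap.flip (TensorProduct.lift (LinearMap.mk₂ k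
      (fun (a : Hc.H x) (b : Hc.H y) => LinearMap.mulRight k b ∘ₗ A Hc h ∘ₗ LinearMap.mulLeft k a)
      (fun a a' b => by ext; simp [add_mul]) (fun c a b => by ext; simp)
      (fun a b b' => by ext; simp [mul_add]) (fun c a b => by ext; simp)))
  have hB : ∀ w a b, B w (a ⊗ₜ b) = A Hc h (a * w) * b := by
    intro w a b; simp [B]
  have key := conv_right Hc h h' (B.flip (D Hc h' s)) (algebraMap k _ (Hc.ε s)) ?_ v
  · rw [← Algebra.smul_def] at key
    rw [← key, LinearMap.flip_apply]
    have : LinearMap.mul' k (Hc.H y) ∘ₗ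
        TensorProduct.map (A Hc h ∘ₗ LinearMap.mulRight k v) LinearMap.id = B v := by
      ext a b; simp [hB]
    exact LinearMap.congr_fun this _
  · intro r
    have g : ∀ p q : Hc.H x ⊗[k] Hc.H y,
        LinearMap.mul' k (Hc.H y) (TensorProduct.map (B.flip p) LinearMap.id q) =
        LinearMap.mul' k (Hc.H y) (TensorProduct.map (A Hc h) LinearMap.id (p * q)) := by
      intro p q
      induction p with
      | zero => simp
      | add p p' hp hp' => simp [add_mul, TensorProduct.map_add_left, hp, hp']
      | tmul a b =>
        induction q with
        | zero => simp
        | add q q' hq hq' => simp [mul_add, hq, hq']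
        | tmul c d => simp [hB, mul_assoc]
    rw [g, ← map_mul, A_left, map_mul, map_mul, ← Algebra.commutes, ← Algebra.smul_def]

section
variable {Sinv : ∀ α : G, Hc.H α⁻¹ →ₗ[k] Hc.H α} (hS : IsAntipodeInv Hc Sinv)

theorem A_T (hS : IsAntipodeInv Hc Sinv) {x y : G} (h : y = x⁻¹) (t : Hc.H y) :
    A Hc h (T Sinv h t) = t := by
  subst h; exact LinearMap.congr_fun (hS x).2 t

theorem T_A (hS : IsAntipodeInv Hc Sinv) {x y : G} (h : y = x⁻¹) (t : Hc.H x) :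
    T Sinv h (A Hc h t) = t := by
  subst h; exact LinearMap.congr_fun (hS x).1 t

theorem T_one (hS : IsAntipodeInv Hc Sinv) {x y : G} (h : y = x⁻¹) : T Sinv h 1 = 1 := by
  rw [← A_one Hc h, T_A hS]

theorem T_mul (hS : IsAntipodeInv Hc Sinv) {x y : G} (h : y = x⁻¹) (u v : Hc.H y) :
    T Sinv h (u * v) = T Sinv h v * T Sinv h u := by
  conv_lhs => rw [← A_T hS h u, ← A_T hS h v, ← A_mul, T_A hS]

theorem T_algebraMap (hS : IsAntipodeInv Hc Sinv) {x y : G} (h : y = x⁻¹) (c : k) :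
    T Sinv h (algebraMap k _ c) = algebraMap k _ c := by
  rw [Algebra.algebraMap_eq_smul_one, map_smul, T_one hS, ← Algebra.algebraMap_eq_smul_one]

/-- `T(t₂) t₁ = ε(t)`. -/
theorem T_left (hS : IsAntipodeInv Hc Sinv) {x y : G} (h : y = x⁻¹) (h' : 1 = x * y)
    (t : Hc.H 1) :
    LinearMap.mul' k (Hc.H x) (TensorProduct.comm k _ _
      (TensorProduct.map LinearMap.id (T Sinv h) (D Hc h' t))) = algebraMap k _ (Hc.ε t) := by
  rw [← T_algebraMap hS h, ← A_left Hc h h']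
  generalize D Hc h' t = s
  induction s with
  | zero => simp
  | add a b ha hb => simp only [map_add, ha, hb]
  | tmul a b => simp [T_mul hS, T_A hS]

/-- `t₂ T(t₁) = ε(t)`. -/
theorem T_right (hS : IsAntipodeInv Hc Sinv) {x y : G} (h : y = x⁻¹) (h' : 1 = y * x)
    (t : Hc.H 1) :
    LinearMap.mul' k (Hc.H x) (TensorProduct.comm k _ _
      (TensorProduct.map (T Sinv h) LinearMap.id (D Hc h' t))) = algebraMap k _ (Hc.ε t) := by
  rw [← T_algebraMap hS h, ← A_right Hc h h']
  generalize D Hc h' t = s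
  induction s with
  | zero => simp
  | add a b ha hb => simp only [map_add, ha, hb]
  | tmul a b => simp [T_mul hS, T_A hS]

/-- If `F(t₂) i(t₁) = ε(t) 1`, then `F(t) = i(T(t))`. -/
theorem conv_cop (hS : IsAntipodeInv Hc Sinv) {x y : G} (h : y = x⁻¹) (h' : 1 = x * y)
    {B : Type*} [Ring B] [Algebra k B] (i : Hc.H x →ₐ[k] B)
    (F : Hc.H y →ₗ[k] B)
    (hF : ∀ t : Hc.H 1, LinearMap.mul' k B (TensorProduct.comm k _ _
      (TensorProduct.map i.toLinearMap F (D Hc h' t))) = algebraMap k _ (Hc.ε t)) (t : Hc.H y) :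
    F t = i (T Sinv h t) := by
  have hyx : 1 = y * x := by rw [h', mul_comm]
  have co := D_coassoc Hc (one_mul y).symm hyx h' (mul_one y).symm t
  let W : Hc.H y ⊗[k] (Hc.H x ⊗[k] Hc.H y) →ₗ[k] B :=
    LinearMap.mul' k _ ∘ₗ (TensorProduct.comm k _ _).toLinearMap ∘ₗ
      TensorProduct.map (i.toLinearMap ∘ₗ T Sinv h)
        (LinearMap.mul' k _ ∘ₗ (TensorProduct.comm k _ _).toLinearMap ∘ₗ
          TensorProduct.map i.toLinearMap F)
  have e1 : W ∘ₗ TensorProduct.map LinearMap.id (D Hc h').toLinearMap =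
      i.toLinearMap ∘ₗ T Sinv h ∘ₗ (TensorProduct.rid k _).toLinearMap ∘ₗ
        TensorProduct.map LinearMap.id Hc.ε.toLinearMap := by
    ext u v
    simp [W, hF, Algebra.algebraMap_eq_smul_one]
  have e2 : W ∘ₗ (TensorProduct.assoc k _ _ _).toLinearMap ∘ₗ
      TensorProduct.map (D Hc hyx).toLinearMap LinearMap.id =
      F ∘ₗ (TensorProduct.lid k _).toLinearMap ∘ₗ
        TensorProduct.map Hc.ε.toLinearMap LinearMap.id := by
    have e3 : W ∘ₗ (TensorProduct.assoc k _ _ _).toLinearMap =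
        LinearMap.mul' k _ ∘ₗ (TensorProduct.comm k _ _).toLinearMap ∘ₗ TensorProduct.map
          (i.toLinearMap ∘ₗ LinearMap.mul' k _ ∘ₗ (TensorProduct.comm k _ _).toLinearMap ∘ₗ
            TensorProduct.map (T Sinv h) LinearMap.id) F := by
      ext u v w
      simp [W, mul_assoc]
    rw [← LinearMap.comp_assoc, e3]
    ext u v
    simp [T_right hS h hyx, Algebra.algebraMap_eq_smul_one]
  have f1 := LinearMap.congr_fun e1 (D Hc (mul_one y).symm t)
  have f2 := LinearMap.congr_fun e2 (D Hc (one_mul y).symm t)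
  simp only [LinearMap.comp_apply, LinearEquiv.coe_coe, D_counit_left, D_counit_right,
    AlgHom.toLinearMap_apply] at f1 f2
  rw [← f1, ← f2, ← co]

/-- `Δ(T(t₂)) (1 ⊗ t₁) = T(t) ⊗ 1`. -/
theorem T_star (hS : IsAntipodeInv Hc Sinv) {x y a b : G} (hx : y = x⁻¹) (hxab : x = a * b)
    {c : G} (ha : c = a⁻¹) (hc : c = b * y) (t : Hc.H c) :
    LinearMap.mul' k (Hc.H a ⊗[k] Hc.H b) (TensorProduct.comm k _ _
      (TensorProduct.map
        (Algebra.TensorProduct.includeRight : Hc.H b →ₐ[k] Hc.H a ⊗[k] Hc.H b).toLinearMap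
        ((D Hc hxab).toLinearMap ∘ₗ T Sinv hx) (D Hc hc t)))
      = T Sinv ha t ⊗ₜ 1 := by
  have hac : 1 = a * c := by rw [ha, mul_inv_cancel]
  have hxy : 1 = x * y := by rw [hx, mul_inv_cancel]
  let F : Hc.H c →ₗ[k] Hc.H a ⊗[k] Hc.H b :=
    LinearMap.mul' k (Hc.H a ⊗[k] Hc.H b) ∘ₗ (TensorProduct.comm k _ _).toLinearMap ∘ₗ
      TensorProduct.map
        (Algebra.TensorProduct.includeRight : Hc.H b →ₐ[k] Hc.H a ⊗[k] Hc.H b).toLinearMap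
        ((D Hc hxab).toLinearMap ∘ₗ T Sinv hx) ∘ₗ (D Hc hc).toLinearMap
  refine conv_cop hS ha hac
    (Algebra.TensorProduct.includeLeft : Hc.H a →ₐ[k] Hc.H a ⊗[k] Hc.H b) F ?_ t
  intro s
  have co := D_coassoc Hc hxy hxab hc hac s
  have e : LinearMap.mul' k (Hc.H a ⊗[k] Hc.H b) ∘ₗ (TensorProduct.comm k _ _).toLinearMap ∘ₗ
      TensorProduct.map
        (Algebra.TensorProduct.includeLeft : Hc.H a →ₐ[k] Hc.H a ⊗[k] Hc.H b).toLinearMap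
        (LinearMap.mul' k (Hc.H a ⊗[k] Hc.H b) ∘ₗ (TensorProduct.comm k _ _).toLinearMap ∘ₗ
      TensorProduct.map
        (Algebra.TensorProduct.includeRight : Hc.H b →ₐ[k] Hc.H a ⊗[k] Hc.H b).toLinearMap
        ((D Hc hxab).toLinearMap ∘ₗ T Sinv hx)) ∘ₗ (TensorProduct.assoc k _ _ _).toLinearMap =
      LinearMap.mul' k (Hc.H a ⊗[k] Hc.H b) ∘ₗ (TensorProduct.comm k _ _).toLinearMap ∘ₗ
      TensorProduct.map LinearMap.id ((D Hc hxab).toLinearMap ∘ₗ T Sinv hx) := by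
    ext u v w
    simp [mul_assoc]
  have e' := LinearMap.congr_fun e
    (TensorProduct.map (D Hc hxab).toLinearMap LinearMap.id (D Hc hxy s))
  have e2 : LinearMap.mul' k (Hc.H a ⊗[k] Hc.H b) ∘ₗ (TensorProduct.comm k _ _).toLinearMap ∘ₗ
      TensorProduct.map LinearMap.id ((D Hc hxab).toLinearMap ∘ₗ T Sinv hx) ∘ₗ
      TensorProduct.map (D Hc hxab).toLinearMap LinearMap.id =
      (D Hc hxab).toLinearMap ∘ₗ LinearMap.mul' k (Hc.H x) ∘ₗ
        (TensorProduct.comm k _ _).toLinearMap ∘ₗ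
        TensorProduct.map LinearMap.id (T Sinv hx) := by
    ext u v
    simp
  have e2' := LinearMap.congr_fun e2 (D Hc hxy s)
  simp only [LinearMap.comp_apply, LinearEquiv.coe_coe, T_left hS, AlgHom.toLinearMap_apply,
    AlgHom.commutes] at e' e2'
  rw [← e2', ← e', co]
  have e3 : TensorProduct.map
      (Algebra.TensorProduct.includeLeft : Hc.H a →ₐ[k] Hc.H a ⊗[k] Hc.H b).toLinearMap F =
      TensorProduct.map
        (Algebra.TensorProduct.includeLeft : Hc.H a →ₐ[k] Hc.H a ⊗[k] Hc.H b).toLinearMap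
        (LinearMap.mul' k (Hc.H a ⊗[k] Hc.H b) ∘ₗ (TensorProduct.comm k _ _).toLinearMap ∘ₗ
      TensorProduct.map
        (Algebra.TensorProduct.includeRight : Hc.H b →ₐ[k] Hc.H a ⊗[k] Hc.H b).toLinearMap
        ((D Hc hxab).toLinearMap ∘ₗ T Sinv hx)) ∘ₗ
      TensorProduct.map LinearMap.id (D Hc hc).toLinearMap := by
    ext u v
    simp [F]
  rw [e3]
  rfl

end

theorem pMapM_coinv (Mc : PoissonHopfModule Ac)
    (φ : ∀ α : G, Hc.H α →ₗ[k] Ac.A α) (Sinv : ∀ α : G, Hc.H α⁻¹ →ₗ[k] Hc.H α)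
    (hφcol : PhiColinear φ) (hS : IsAntipodeInv Hc Sinv) (x : Mc.M 1) (a b : G) :
    Mc.ρ a b (pMapM Mc φ Sinv (a * b) x) = pMapM Mc φ Sinv a x ⊗ₜ[k] (1 : Hc.H b) := by
  have h1 : (1 : G) = (a * b) * (a * b)⁻¹ := (mul_inv_cancel _).symm
  have h4 : (1 : G) = a * a⁻¹ := (mul_inv_cancel _).symm
  have h3 : a⁻¹ = b * (a * b)⁻¹ := by rw [mul_inv]; simp
  have co := R_coassoc Mc h1 rfl h3 h4 x
  -- the action of `H_a ⊗ H_b` on `M_a ⊗ H_b`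
  let N : Mc.M a ⊗[k] Hc.H b →ₗ[k] Hc.H a ⊗[k] Hc.H b →ₗ[k] Mc.M a ⊗[k] Hc.H b :=
    (LinearMap.flip (TensorProduct.map₂ (Mc.smul a ∘ₗ φ a) (LinearMap.mul k (Hc.H b))))
  have hN : ∀ m g u v, N (m ⊗ₜ g) (u ⊗ₜ v) = Mc.smul a (φ a u) m ⊗ₜ (v * g) := by
    intro m g u v; simp [N]
  have hsm : ∀ (u : Hc.H (a * b)) (m : Mc.M (a * b)),
      Mc.ρ a b (Mc.smul (a * b) (φ (a * b) u) m) = N (Mc.ρ a b m) (Hc.Δ a b u) := by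
    intro u m
    have s := LinearMap.congr_fun (Mc.smul_comp a b) (φ (a * b) u ⊗ₜ m)
    have c := LinearMap.congr_fun (hφcol a b) u
    simp only [LinearMap.comp_apply, TensorProduct.lift.tmul, TensorProduct.map_tmul,
      AlgHom.toLinearMap_apply, LinearEquiv.coe_coe] at s c
    rw [s, c]
    generalize Mc.ρ a b m = p
    generalize Hc.Δ a b u = q
    induction p with
    | zero => simp
    | add p p' hp hp' => simp [TensorProduct.tmul_add, hp, hp']
    | tmul p p' =>
      induction q with
      | zero => simp
      | add q q' hq hq' => simp [TensorProduct.add_tmul, hq, hq']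
      | tmul q q' => simp [hN]
  let L : (Mc.M a ⊗[k] Hc.H b) ⊗[k] Hc.H (a * b)⁻¹ →ₗ[k] Mc.M a ⊗[k] Hc.H b :=
    TensorProduct.lift N ∘ₗ
      TensorProduct.map LinearMap.id ((Hc.Δ a b).toLinearMap ∘ₗ Sinv (a * b))
  have e1 : Mc.ρ a b (pMapM Mc φ Sinv (a * b) x) =
      L (TensorProduct.map (R Mc (rfl : a * b = a * b)) LinearMap.id (R Mc h1 x)) := by
    have : Mc.ρ a b ∘ₗ TensorProduct.lift ((Mc.smul (a * b)).flip) ∘ₗ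
        TensorProduct.map LinearMap.id (φ (a * b) ∘ₗ Sinv (a * b)) =
        L ∘ₗ TensorProduct.map (R Mc (rfl : a * b = a * b)) LinearMap.id := by
      ext u v
      simp [L, hsm]
      rfl
    rw [R_apply]
    exact LinearMap.congr_fun this _
  have e2 : L ∘ₗ (TensorProduct.assoc k _ _ _).symm.toLinearMap ∘ₗ
      TensorProduct.map LinearMap.id (D Hc h3).toLinearMap =
      (TensorProduct.mk k (Mc.M a) (Hc.H b)).flip 1 ∘ₗ
      TensorProduct.lift ((Mc.smul a).flip) ∘ₗ
        TensorProduct.map LinearMap.id (φ a ∘ₗ Sinv a) := by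
    ext m t
    have st := T_star hS (rfl : (a * b)⁻¹ = (a * b)⁻¹) rfl rfl h3 t
    have g : ∀ q : Hc.H b ⊗[k] Hc.H (a * b)⁻¹,
        L ((TensorProduct.assoc k _ _ _).symm (m ⊗ₜ q)) =
        N (m ⊗ₜ 1) (LinearMap.mul' k (Hc.H a ⊗[k] Hc.H b) (TensorProduct.comm k _ _
      (TensorProduct.map
        (Algebra.TensorProduct.includeRight : Hc.H b →ₐ[k] Hc.H a ⊗[k] Hc.H b).toLinearMap
        ((Hc.Δ a b).toLinearMap ∘ₗ Sinv (a * b)) q))) := by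
      intro q
      induction q with
      | zero => simp
      | add q q' hq hq' => simp only [TensorProduct.tmul_add, map_add, hq, hq']
      | tmul q q' =>
        simp [L]
        generalize Hc.Δ a b (Sinv (a * b) q') = r
        induction r with
        | zero => simp
        | add r r' hr hr' => simp only [add_mul, map_add, hr, hr']
        | tmul r r' => simp [hN]
    have st' := (g (D Hc h3 t)).trans (congrArg (N (m ⊗ₜ 1)) st)
    simp only [hN] at st'
    simp
    rw [st', one_mul]
    rfl
  rw [e1]
  have f2 := LinearMap.congr_fun e2 (R Mc h4 x)
  simp only [LinearMap.comp_apply, LinearEquiv.coe_coe] at f2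
  rw [← co, LinearEquiv.symm_apply_apply] at f2
  rw [f2, R_apply]
  rfl

theorem famCast_fam {H : G → Type*}
    [∀ α, AddCommMonoid (H α)] [∀ α, Module k (H α)] (m : ∀ α, H α) {x y : G} (h : x = y) :
    famCast (k := k) h (m x) = m y := by subst h; rfl

end PMapAux

/-- The families `(p^M_α(m))_α`, `m ∈ M_e`, are exactly the coinvariant families:
`{(p^M_α(m))_α | m ∈ M_e} = M^{coH}`. -/
theorem pMap_image_eq_coinv (Mc : PoissonHopfModule Ac)
    (φ : ∀ α : G, Hc.H α →ₗ[k] Ac.A α) (Sinv : ∀ α : G, Hc.H α⁻¹ →ₗ[k] Hc.H α)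
    (hφcol : PhiColinear φ) (hφ1 : ∀ α : G, φ α (1 : Hc.H α) = 1)
    (hSinv : IsAntipodeInv Hc Sinv) :
    {m : ∀ α : G, Mc.M α | ∃ x : Mc.M 1, ∀ α : G, m α = pMapM Mc φ Sinv α x}
      = {m : ∀ α : G, Mc.M α | Mc.IsCoinv m} := by
  ext m
  constructor
  · rintro ⟨x, hx⟩ a b
    rw [hx, hx]
    exact PMapAux.pMapM_coinv Mc φ Sinv hφcol hSinv x a b
  · intro hm
    refine ⟨m 1, fun α => ?_⟩
    have h := hm α α⁻¹
    have hT : Sinv α 1 = 1 := PMapAux.T_one hSinv (rfl : α⁻¹ = α⁻¹)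
    simp only [pMapM, LinearMap.comp_apply, PMapAux.famCast_fam, h, TensorProduct.map_tmul, hT,
      hφ1, TensorProduct.lift.tmul, LinearMap.flip_apply, Mc.one_smul, LinearMap.id_apply]
end
end

section
/- Let M be a Poisson (A,H)-Hopf module and φ : H → A a right H-colinear algebra map with φ_α(1) = 1. If the action ⋄' of A_e on M^{coH} (given by a ⋄' p_α^M(m) = p_α^M(a ⋄ m)) is trivial, then M^{AcoH} = M^{coH}. -/
open TensorProduct

noncomputable section

set_option synthInstance.maxHeartbeats 1000000
set_option maxHeartbeats 2000000

variable {k G : Type*} [Field k] [CommGroup G]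

variable {Hc : HopfGCoalgebra k G} {Ac : GComodulePoissonAlgebra Hc}

/-- Abstract anti-multiplicativity of the antipode. -/
theorem aux_antimul {X Y E : Type*} [Ring X] [Algebra k X] [Ring Y] [Algebra k Y]
    [Ring E] [Algebra k E] (d1 : E →ₐ[k] X ⊗[k] Y) (d2 : E →ₐ[k] Y ⊗[k] X)
    (l : X → E ⊗[k] X) (r : X → X ⊗[k] E) (ε : E →ₐ[k] k) (S : X →ₗ[k] Y)
    (hco : ∀ x, TensorProduct.assoc k X Y X (TensorProduct.map d1.toLinearMap LinearMap.id (l x))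
      = TensorProduct.map LinearMap.id d2.toLinearMap (r x))
    (hl : ∀ x, TensorProduct.lid k X (TensorProduct.map ε.toLinearMap LinearMap.id (l x)) = x)
    (hr : ∀ x, TensorProduct.rid k X (TensorProduct.map LinearMap.id ε.toLinearMap (r x)) = x)
    (h1 : ∀ e, LinearMap.mul' k Y (TensorProduct.map S LinearMap.id (d1 e)) = algebraMap k Y (ε e))
    (h2 : ∀ e, LinearMap.mul' k Y (TensorProduct.map LinearMap.id S (d2 e)) = algebraMap k Y (ε e))
    (x y : X) : S (x * y) = S y * S x := by
  -- `Ψ a a' (b ⊗ c) (b' ⊗ c') = S (a a') b b' S c' S c`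
  let P : (X ⊗[k] (Y ⊗[k] X)) →ₗ[k] (X ⊗[k] (Y ⊗[k] X)) →ₗ[k] Y :=
    TensorProduct.lift <| LinearMap.mk₂ k
      (fun a (w : Y ⊗[k] X) =>
        (TensorProduct.lift (LinearMap.mk₂ k
          (fun a' (w' : Y ⊗[k] X) => S (a * a') *
            TensorProduct.lift (LinearMap.mk₂ k (fun b c => b *
              LinearMap.mul' k Y (TensorProduct.map LinearMap.id S w') * S c)
              (by intros; simp only [add_mul])
              (by intros; simp only [smul_mul_assoc])
              (by intros; simp only [map_add, mul_add])
              (by intros; simp only [map_smul, mul_smul_comm])) w)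
          (by intros; simp only [map_add, mul_add, add_mul])
          (by intros; simp only [map_smul, mul_smul_comm, smul_mul_assoc])
          (by
            intro a' w1 w2
            rw [← mul_add]; congr 1
            induction w using TensorProduct.induction_on with
            | zero => simp
            | tmul b c => simp [mul_add, add_mul]
            | add u v hu hv =>
              rw [(TensorProduct.lift _).map_add, hu, hv, (TensorProduct.lift _).map_add,
                (TensorProduct.lift _).map_add]
              abel)
          (by
            intro t a' w1
            rw [← mul_smul_comm]; congr 1
            induction w using TensorProduct.induction_on with
            | zero => simp
            | tmul b c => simp
            | add u v hu hv => simp only [map_add, hu, hv, smul_add])) :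
          (X ⊗[k] (Y ⊗[k] X)) →ₗ[k] Y))
      (by intros; ext; simp [add_mul])
      (by intros; ext; simp)
      (by intros; ext; simp [mul_add])
      (by intros; ext; simp)
  have hP : ∀ a b c a' b' c', P (a ⊗ₜ (b ⊗ₜ c)) (a' ⊗ₜ (b' ⊗ₜ c'))
      = S (a * a') * (b * (b' * S c') * S c) := by
    intros; simp [P]
  have hP2 : ∀ a b c a' w', P (a ⊗ₜ (b ⊗ₜ c)) (a' ⊗ₜ w')
      = S (a * a') * (b * LinearMap.mul' k Y (TensorProduct.map LinearMap.id S w') * S c) := by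
    intros; simp [P]
  have hA : ∀ u v : E ⊗[k] X,
      P (TensorProduct.assoc k X Y X (TensorProduct.map d1.toLinearMap LinearMap.id u))
        (TensorProduct.assoc k X Y X (TensorProduct.map d1.toLinearMap LinearMap.id v))
      = S (TensorProduct.lid k X (TensorProduct.map ε.toLinearMap LinearMap.id v)) *
        S (TensorProduct.lid k X (TensorProduct.map ε.toLinearMap LinearMap.id u)) := by
    intro u v
    induction u using TensorProduct.induction_on with
    | zero => simp
    | add u1 u2 hu1 hu2 => simp only [map_add, LinearMap.add_apply, hu1, hu2, mul_add]
    | tmul e c =>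
    induction v using TensorProduct.induction_on with
    | zero => simp
    | add u1 u2 hu1 hu2 => simp only [map_add, hu1, hu2, add_mul]
    | tmul e' c' =>
    have key : ∀ p q : X ⊗[k] Y, P (TensorProduct.assoc k X Y X (p ⊗ₜ c))
        (TensorProduct.assoc k X Y X (q ⊗ₜ c')) =
        LinearMap.mul' k Y (TensorProduct.map S LinearMap.id (p * q)) * (S c' * S c) := by
      intro p q
      induction p using TensorProduct.induction_on with
      | zero => simp
      | add u1 u2 hu1 hu2 =>
        simp only [TensorProduct.add_tmul, map_add, LinearMap.add_apply, hu1, hu2, add_mul]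
      | tmul a b =>
      induction q using TensorProduct.induction_on with
      | zero => simp
      | add u1 u2 hu1 hu2 =>
        simp only [TensorProduct.add_tmul, map_add, hu1, hu2, add_mul, mul_add]
      | tmul a' b' =>
        simp only [TensorProduct.assoc_tmul, hP, Algebra.TensorProduct.tmul_mul_tmul,
          TensorProduct.map_tmul, LinearMap.mul'_apply, LinearMap.id_apply, mul_assoc]
    simp only [TensorProduct.map_tmul, AlgHom.toLinearMap_apply, LinearMap.id_apply, key,
      TensorProduct.lid_tmul, map_smul]
    rw [← map_mul, h1, map_mul, map_mul, Algebra.algebraMap_eq_smul_one,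
      Algebra.algebraMap_eq_smul_one]
    simp only [smul_mul_assoc, mul_smul_comm, one_mul]
    rw [smul_comm]
  have hB : ∀ u v : X ⊗[k] E,
      P (TensorProduct.map LinearMap.id d2.toLinearMap u)
        (TensorProduct.map LinearMap.id d2.toLinearMap v)
      = S (TensorProduct.rid k X (TensorProduct.map LinearMap.id ε.toLinearMap u) *
          TensorProduct.rid k X (TensorProduct.map LinearMap.id ε.toLinearMap v)) := by
    intro u v
    induction u using TensorProduct.induction_on with
    | zero => simp
    | add u1 u2 hu1 hu2 => simp only [map_add, LinearMap.add_apply, hu1, hu2, add_mul]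
    | tmul a e =>
    induction v using TensorProduct.induction_on with
    | zero => simp
    | add u1 u2 hu1 hu2 => simp only [map_add, hu1, hu2, mul_add]
    | tmul a' e' =>
    have key : ∀ w : Y ⊗[k] X, P (a ⊗ₜ w) (a' ⊗ₜ d2 e') =
        ε e' • (S (a * a') * LinearMap.mul' k Y (TensorProduct.map LinearMap.id S w)) := by
      intro w
      induction w using TensorProduct.induction_on with
      | zero => simp
      | add u1 u2 hu1 hu2 =>
        simp only [TensorProduct.tmul_add, map_add, LinearMap.add_apply, hu1, hu2, mul_add,
          smul_add]
      | tmul b c =>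
        rw [hP2, h2, Algebra.algebraMap_eq_smul_one]
        simp
    simp only [TensorProduct.map_tmul, AlgHom.toLinearMap_apply, LinearMap.id_apply, key,
      TensorProduct.rid_tmul]
    rw [h2, Algebra.algebraMap_eq_smul_one]
    simp only [smul_mul_assoc, mul_smul_comm, mul_one, map_smul]
  have := hA (l x) (l y)
  rw [hco, hco, hB, hl, hl, hr, hr] at this
  exact this

/-- `h₂ S⁻¹(h₁) = ε(h)`. -/
theorem aux_sinv {X Y E : Type*} [Ring X] [Algebra k X] [Ring Y] [Algebra k Y]
    [Ring E] [Algebra k E] (d1 : E →ₐ[k] X ⊗[k] Y) (d2 : E →ₐ[k] Y ⊗[k] X)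
    (ε : E →ₐ[k] k) (S : X →ₗ[k] Y) (T : Y →ₗ[k] X)
    (hTS : ∀ x, T (S x) = x) (hST : ∀ y, S (T y) = y)
    (hS : ∀ x y, S (x * y) = S y * S x)
    (h1 : ∀ e, LinearMap.mul' k Y (TensorProduct.map S LinearMap.id (d1 e)) = algebraMap k Y (ε e))
    (h2 : ∀ e, LinearMap.mul' k Y (TensorProduct.map LinearMap.id S (d2 e)) = algebraMap k Y (ε e))
    (e : E) :
    TensorProduct.lift ((LinearMap.mul k X).flip ∘ₗ T) (d2 e) = algebraMap k X (ε e) := by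
  have hS1 : S 1 = 1 := by
    have := h1 1
    rw [map_one, Algebra.TensorProduct.one_def] at this
    simpa using this
  have key : ∀ w : Y ⊗[k] X, S (TensorProduct.lift ((LinearMap.mul k X).flip ∘ₗ T) w)
      = LinearMap.mul' k Y (TensorProduct.map LinearMap.id S w) := by
    intro w
    induction w using TensorProduct.induction_on with
    | zero => simp
    | add u v hu hv => simp only [map_add, hu, hv]
    | tmul b c => simp [hS, hST]
  rw [← hTS (TensorProduct.lift _ _), key, h2, Algebra.algebraMap_eq_smul_one, map_smul,
    ← hS1, hTS, Algebra.algebraMap_eq_smul_one]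

/-- Comultiplication with flexible index. -/
def dlt (Hc : HopfGCoalgebra k G) {α β γ : G} (h : γ = α * β) :
    Hc.H γ →ₐ[k] Hc.H α ⊗[k] Hc.H β := by subst h; exact Hc.Δ α β

theorem dlt_eq {α β γ : G} (h : γ = α * β) (x : Hc.H γ) :
    dlt Hc h x = Hc.Δ α β (famCast (k := k) h x) := by subst h; rfl

theorem dlt_coassoc {α β γ δ ζ η : G} (h1 : δ = α * β) (h2 : η = δ * γ) (h3 : ζ = β * γ)
    (h4 : η = α * ζ) (x : Hc.H η) :
    TensorProduct.assoc k _ _ _ (TensorProduct.map (dlt Hc h1).toLinearMap LinearMap.id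
      (dlt Hc h2 x)) = TensorProduct.map LinearMap.id (dlt Hc h3).toLinearMap (dlt Hc h4 x) := by
  subst h1 h3 h2
  have := LinearMap.congr_fun (Hc.coassoc α β γ) x
  rw [dlt_eq h4]
  exact this

theorem dlt_counit_left {α : G} (h : α = 1 * α) (x : Hc.H α) :
    TensorProduct.lid k _ (TensorProduct.map Hc.ε.toLinearMap LinearMap.id (dlt Hc h x)) = x := by
  rw [dlt_eq]
  refine (LinearMap.congr_fun (Hc.counit_left α) (famCast (k := k) h x)).trans ?_
  generalize one_mul α = h'
  revert h h'
  generalize 1 * α = β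
  intro h h'; subst h; rfl

theorem dlt_counit_right {α : G} (h : α = α * 1) (x : Hc.H α) :
    TensorProduct.rid k _ (TensorProduct.map LinearMap.id Hc.ε.toLinearMap (dlt Hc h x)) = x := by
  rw [dlt_eq]
  refine (LinearMap.congr_fun (Hc.counit_right α) (famCast (k := k) h x)).trans ?_
  generalize mul_one α = h'
  revert h h'
  generalize α * 1 = β
  intro h h'; subst h; rfl

theorem dlt_antipode_right {α : G} (h : 1 = α⁻¹ * α) (x : Hc.H 1) :
    LinearMap.mul' k _ (TensorProduct.map LinearMap.id (Hc.S α) (dlt Hc h x))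
      = algebraMap k _ (Hc.ε x) := by
  rw [dlt_eq]
  exact LinearMap.congr_fun (Hc.antipode_right α) x

theorem dlt_antipode_left' {α β : G} (h' : α = β⁻¹) (h'' : α⁻¹ = β) (h : 1 = α * β)
    (x : Hc.H 1) :
    LinearMap.mul' k _ (TensorProduct.map (famCast (k := k) h'' ∘ₗ Hc.S α) LinearMap.id
      (dlt Hc h x)) = algebraMap k _ (Hc.ε x) := by
  subst h'
  rw [dlt_eq]
  exact LinearMap.congr_fun (Hc.antipode_left β) x

theorem dlt_antipode_left {α : G} (h : 1 = α * α⁻¹) (x : Hc.H 1) :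
    LinearMap.mul' k _ (TensorProduct.map (Hc.S α) LinearMap.id (dlt Hc h x))
      = algebraMap k _ (Hc.ε x) :=
  dlt_antipode_left' (inv_inv α).symm rfl h x

/-- `h₂ S⁻¹(h₁) = ε(h)` in a Hopf `G`-coalgebra. -/
theorem hopf_sinv (Sinv : ∀ α : G, Hc.H α⁻¹ →ₗ[k] Hc.H α) (hSinv : IsAntipodeInv Hc Sinv)
    (α : G) (h : 1 = α⁻¹ * α) (e : Hc.H 1) :
    TensorProduct.lift ((LinearMap.mul k (Hc.H α)).flip ∘ₗ Sinv α) (dlt Hc h e)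
      = algebraMap k _ (Hc.ε e) := by
  refine aux_sinv (dlt Hc (mul_inv_cancel α).symm) (dlt Hc h) Hc.ε (Hc.S α) (Sinv α)
    (LinearMap.congr_fun (hSinv α).1) (LinearMap.congr_fun (hSinv α).2) ?_
    (dlt_antipode_left _) (dlt_antipode_right _) e
  exact aux_antimul (dlt Hc (mul_inv_cancel α).symm) (dlt Hc h) (dlt Hc (one_mul α).symm)
    (dlt Hc (mul_one α).symm) Hc.ε (Hc.S α) (dlt_coassoc _ _ _ _) (dlt_counit_left _)
    (dlt_counit_right _) (dlt_antipode_left _) (dlt_antipode_right _)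

/-- Coaction on `A` with flexible index. -/
def rhoA (Ac : GComodulePoissonAlgebra Hc) {α β γ : G} (h : γ = α * β) :
    Ac.A γ →ₗ[k] Ac.A α ⊗[k] Hc.H β := (Ac.ρ α β).toLinearMap ∘ₗ famCast (k := k) h

theorem rhoA_coassoc {α β γ δ ζ η : G} (h1 : δ = α * β) (h2 : η = δ * γ) (h3 : ζ = β * γ)
    (h4 : η = α * ζ) (x : Ac.A η) :
    TensorProduct.assoc k _ _ _ (TensorProduct.map (rhoA Ac h1) LinearMap.id
      (rhoA Ac h2 x)) = TensorProduct.map LinearMap.id (dlt Hc h3).toLinearMap (rhoA Ac h4 x) := by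
  subst h1 h3 h2
  exact LinearMap.congr_fun (Ac.coassoc α β γ) x

theorem rhoA_counit {α : G} (h : α = α * 1) (x : Ac.A α) :
    TensorProduct.rid k _ (TensorProduct.map LinearMap.id Hc.ε.toLinearMap (rhoA Ac h x)) = x := by
  refine (LinearMap.congr_fun (Ac.counit α) (famCast (k := k) h x)).trans ?_
  generalize mul_one α = h'
  revert h h'
  generalize α * 1 = β
  intro h h'; subst h; rfl

theorem rhoM_dia (Mc : PoissonHopfModule Ac) {m : ∀ γ : G, Mc.M γ} (hm : Mc.IsCoinv m)
    {α β γ : G} (h : γ = α * β) (a : Ac.A γ) :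
    Mc.ρ α β (famCast (k := k) h (Mc.dia γ a (m γ)))
      = TensorProduct.map ((Mc.dia α).flip (m α)) LinearMap.id (rhoA Ac h a) := by
  subst h
  have h := LinearMap.congr_fun (Mc.dia_comp α β) (a ⊗ₜ m (α * β))
  simp only [LinearMap.comp_apply, TensorProduct.lift.tmul, TensorProduct.map_tmul, hm α β] at h
  refine h.trans ?_
  change _ = TensorProduct.map _ _ ((Ac.ρ α β).toLinearMap a)
  generalize (Ac.ρ α β).toLinearMap a = w
  induction w using TensorProduct.induction_on with
  | zero => simp
  | add u v hu hv => simp only [TensorProduct.add_tmul, map_add, hu, hv]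
  | tmul b c => simp

/-- If the action `⋄'` of `A_e` on `M^{coH}` is trivial, then `M^{AcoH} = M^{coH}`. -/
theorem AcoH_eq_coH (Mc : PoissonHopfModule Ac)
    (φ : ∀ α : G, Hc.H α →ₗ[k] Ac.A α) (Sinv : ∀ α : G, Hc.H α⁻¹ →ₗ[k] Hc.H α)
    (hφcol : PhiColinear φ) (hφ1 : ∀ α : G, φ α (1 : Hc.H α) = 1)
    (hφmul : ∀ (α : G) (x y : Hc.H α), φ α (x * y) = φ α x * φ α y)
    (hSinv : IsAntipodeInv Hc Sinv)
    (htriv : ∀ (α : G) (a : Ac.A 1) (m : Mc.M 1),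
      pMapM Mc φ Sinv α (Mc.dia 1 a m) = 0) :
    ∀ α : G,
      {x : Mc.M α | x ∈ Mc.coinv α ∧ ∀ a : Ac.A α, Mc.dia α a x = 0}
        = Mc.coinv α := by
  intro α
  refine Set.Subset.antisymm (fun x hx => hx.1) (fun x hx => ⟨hx, ?_⟩)
  obtain ⟨m, hm, rfl⟩ := hx
  intro a
  -- `Θ (a ⊗ (h ⊗ c)) = φ (c S⁻¹ h) · (a ⋄ m)`
  let Θ : Ac.A α ⊗[k] (Hc.H α⁻¹ ⊗[k] Hc.H α) →ₗ[k] Mc.M α :=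
    TensorProduct.lift (Mc.smul α).flip ∘ₗ
      TensorProduct.map ((Mc.dia α).flip (m α))
        (φ α ∘ₗ TensorProduct.lift ((LinearMap.mul k (Hc.H α)).flip ∘ₗ Sinv α))
  have h1 : ∀ u : Ac.A 1 ⊗[k] Hc.H α, Θ (TensorProduct.assoc k _ _ _
      (TensorProduct.map (rhoA Ac (mul_inv_cancel α).symm) LinearMap.id u)) = 0 := by
    intro u
    induction u using TensorProduct.induction_on with
    | zero => simp
    | add u v hu hv => simp only [map_add, hu, hv, add_zero]
    | tmul b c =>
      have key : ∀ w : Ac.A α ⊗[k] Hc.H α⁻¹, Θ (TensorProduct.assoc k _ _ _ (w ⊗ₜ c)) =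
          Mc.smul α (φ α c) (TensorProduct.lift ((Mc.smul α).flip)
            (TensorProduct.map LinearMap.id (φ α ∘ₗ Sinv α)
              (TensorProduct.map ((Mc.dia α).flip (m α)) LinearMap.id w))) := by
        intro w
        induction w using TensorProduct.induction_on with
        | zero => simp
        | add u v hu hv => simp only [TensorProduct.add_tmul, map_add, hu, hv]
        | tmul b c => simp [Θ, hφmul, Mc.mul_smul]
      rw [TensorProduct.map_tmul, LinearMap.id_apply, key, ← rhoM_dia Mc hm]
      have := htriv α b (m 1)
      rw [pMapM] at this
      simp only [LinearMap.comp_apply] at this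
      rw [this, map_zero]
  have h2 : ∀ v : Ac.A α ⊗[k] Hc.H 1, Θ (TensorProduct.map LinearMap.id
      (dlt Hc (inv_mul_cancel α).symm).toLinearMap v) =
      Mc.dia α (TensorProduct.rid k _ (TensorProduct.map LinearMap.id Hc.ε.toLinearMap v))
        (m α) := by
    intro v
    induction v using TensorProduct.induction_on with
    | zero => simp
    | add u v hu hv => simp only [map_add, LinearMap.add_apply, hu, hv]
    | tmul b e =>
      simp only [Θ, LinearMap.comp_apply, TensorProduct.map_tmul, AlgHom.toLinearMap_apply,
        LinearMap.id_apply, hopf_sinv Sinv hSinv, TensorProduct.lift.tmul, LinearMap.flip_apply,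
        TensorProduct.rid_tmul, Algebra.algebraMap_eq_smul_one, map_smul, hφ1,
        LinearMap.smul_apply, Mc.one_smul]
  have h3 := h2 (rhoA Ac (mul_one α).symm a)
  rw [rhoA_counit, ← rhoA_coassoc (mul_inv_cancel α).symm (one_mul α).symm, h1] at h3
  exact h3.symm
end
end
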